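/- arXiv:2007.02781 — 6 statements merged into one kernel-verified Lean document; each statement's English description precedes it below -/
import Mathlib

section
/- Let 0 < θ₀ < π/2 and A > 0. Let a, b, c be points of the Euclidean plane ℝ² such that the interior angles ∠abc and ∠acb are each at least θ₀, and such that the area of the triangle with vertices a, b, c, namely (1/2)·|det(b − a, c − a)| (the absolute value of the determinant of the 2×2 matrix whose columns are b − a and c − a, halved), is at most A. Then dist(b,c) ≤ 2·√(A·(cos θ₀/sin θ₀)). -/
open Real EuclideanGeometry

/-- If the angle between `x - y` and `z - y` is at least `θ`, then
`⟪x - y, z - y⟫ sin θ ≤ |det (x - y, z - y)| cos θ`. -/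
theorem inner_mul_sin_le_abs_det_mul_cos {θ : ℝ} (hθ0 : 0 ≤ θ) (hθ1 : θ ≤ π / 2)
    {x y z : EuclideanSpace ℝ (Fin 2)} (h : θ ≤ ∠ x y z) :
    ((x 0 - y 0) * (z 0 - y 0) + (x 1 - y 1) * (z 1 - y 1)) * sin θ ≤
      |(x 0 - y 0) * (z 1 - y 1) - (x 1 - y 1) * (z 0 - y 0)| * cos θ := by
  have hsin : 0 ≤ sin θ := sin_nonneg_of_nonneg_of_le_pi hθ0 (by linarith [pi_pos])
  have hcos : 0 ≤ cos θ := cos_nonneg_of_mem_Icc ⟨by linarith [pi_pos], hθ1⟩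
  have hle : cos (∠ x y z) ≤ cos θ := cos_le_cos_of_nonneg_of_le_pi hθ0 (angle_le_pi _ _ _) h
  have hinner : inner ℝ (x - y) (z - y) ≤ cos θ * (‖x - y‖ * ‖z - y‖) := by
    rw [← InnerProductGeometry.cos_angle_mul_norm_mul_norm]
    exact mul_le_mul_of_nonneg_right hle (by positivity)
  have hx := EuclideanSpace.real_norm_sq_eq (x - y)
  have hz := EuclideanSpace.real_norm_sq_eq (z - y)
  simp only [PiLp.inner_apply, Fin.sum_univ_two, PiLp.sub_apply, RCLike.inner_apply,
    conj_trivial] at hinner hx hz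
  set p := (x 0 - y 0) * (z 0 - y 0) + (x 1 - y 1) * (z 1 - y 1) with hp
  set D := (x 0 - y 0) * (z 1 - y 1) - (x 1 - y 1) * (z 0 - y 0) with hD
  have hpr : p ≤ cos θ * (‖x - y‖ * ‖z - y‖) := by linarith
  have hr : (‖x - y‖ * ‖z - y‖) ^ 2 = D ^ 2 + p ^ 2 := by
    rw [mul_pow, hx, hz, hp, hD]
    ring
  rcases le_total p 0 with hp0 | hp0
  · exact (mul_nonpos_of_nonpos_of_nonneg hp0 hsin).trans (by positivity)
  · refine (sq_le_sq₀ (by positivity) (by positivity)).1 ?_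
    have hsq := pow_le_pow_left₀ hp0 hpr 2
    rw [mul_pow, hr] at hsq
    rw [mul_pow, mul_pow, sq_abs, sin_sq]
    linarith

/-- A Euclidean triangle of area at most `A` whose two base angles are at least `θ₀` has
base of length at most `2 √(A cot θ₀)`. -/
theorem base_le_of_area_le (θ₀ A : ℝ) (hθ0 : 0 < θ₀) (hθ1 : θ₀ < π / 2) (hA : 0 < A)
    (a b c : EuclideanSpace ℝ (Fin 2))
    (h2 : θ₀ ≤ ∠ a b c) (h3 : θ₀ ≤ ∠ a c b)
    (harea : (1 / 2) * |(b 0 - a 0) * (c 1 - a 1) - (b 1 - a 1) * (c 0 - a 0)| ≤ A) :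
    dist b c ≤ 2 * Real.sqrt (A * (Real.cos θ₀ / Real.sin θ₀)) := by
  have hsin : 0 < sin θ₀ := sin_pos_of_pos_of_lt_pi hθ0 (by linarith [pi_pos])
  have hcos : 0 < cos θ₀ := cos_pos_of_mem_Ioo ⟨by linarith [pi_pos], hθ1⟩
  have hb := inner_mul_sin_le_abs_det_mul_cos hθ0.le hθ1.le h2
  have hc := inner_mul_sin_le_abs_det_mul_cos hθ0.le hθ1.le h3
  set D := (b 0 - a 0) * (c 1 - a 1) - (b 1 - a 1) * (c 0 - a 0) with hD
  have hDb : (a 0 - b 0) * (c 1 - b 1) - (a 1 - b 1) * (c 0 - b 0) = -D := by rw [hD]; ring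
  have hDc : (a 0 - c 0) * (b 1 - c 1) - (a 1 - c 1) * (b 0 - c 0) = D := by rw [hD]; ring
  rw [hDb, abs_neg] at hb
  rw [hDc] at hc
  have hdist : dist b c ^ 2 = (b 0 - c 0) ^ 2 + (b 1 - c 1) ^ 2 := by
    rw [dist_eq_norm, EuclideanSpace.real_norm_sq_eq]
    simp [Fin.sum_univ_two]
  have hDA : |D| * cos θ₀ ≤ 2 * A * cos θ₀ :=
    mul_le_mul_of_nonneg_right (by linarith) hcos.le
  have hquarter : (dist b c / 2) ^ 2 ≤ A * (cos θ₀ / sin θ₀) := by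
    rw [← mul_div_assoc, le_div_iff₀ hsin, div_pow, hdist]
    linarith
  linarith [le_sqrt_of_sq_le hquarter]
end

section
/- Let p be a point of the hyperbolic upper half-plane ℍ with Re(p) = x ≥ 0 and Im(p) = y > 0, and let Y = {z ∈ ℍ : Re(z) = 0} be the vertical geodesic over 0. Then the hyperbolic distance from p to the set Y equals arsinh(x/y), i.e. infDist(p, Y) = arsinh(x/y). -/
open Real

/-- The hyperbolic cosine of `arsinh (x / y)` is the ratio of the modulus of `x + i y` to `y`. -/
theorem cosh_arsinh_div (x : ℝ) {y : ℝ} (hy : 0 < y) :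
    cosh (arsinh (x / y)) = √(x ^ 2 + y ^ 2) / y := by
  have h : 1 + (x / y) ^ 2 = (x ^ 2 + y ^ 2) / y ^ 2 := by
    field_simp
    ring
  rw [cosh_arsinh, h, sqrt_div (by positivity), sqrt_sq hy.le]

/-- The hyperbolic distance in the upper half-plane from a point `p` with `re p = x ≥ 0`,
`im p = y > 0` to the vertical geodesic over `0` equals `arsinh (x / y)`. -/
theorem infDist_to_vertical_geodesic (p : UpperHalfPlane) (x y : ℝ)
    (hx : p.re = x) (hx0 : 0 ≤ x) (hy : p.im = y) (hy0 : 0 < y) :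
    Metric.infDist p {z : UpperHalfPlane | z.re = 0} = Real.arsinh (x / y) := by
  have hr : 0 ≤ arsinh (x / y) := arsinh_nonneg_iff.2 (by positivity)
  have hs : 0 < √(x ^ 2 + y ^ 2) := by positivity
  have hsq : √(x ^ 2 + y ^ 2) ^ 2 = x ^ 2 + y ^ 2 := sq_sqrt (by positivity)
  have hcosh := cosh_arsinh_div x hy0
  set s := √(x ^ 2 + y ^ 2)
  let q : UpperHalfPlane := ⟨⟨0, s⟩, hs⟩
  have hq : q ∈ {z : UpperHalfPlane | z.re = 0} := rfl
  have hq_im : q.im = s := rfl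
  have hq_re : q.re = 0 := rfl
  apply le_antisymm
  · refine (Metric.infDist_le_dist_of_mem hq).trans ?_
    rw [← abs_of_nonneg (dist_nonneg (x := p) (y := q)), ← abs_of_nonneg hr, ← cosh_le_cosh,
      hcosh, UpperHalfPlane.cosh_dist', hx, hy, hq_im, hq_re]
    apply le_of_eq
    field_simp
    linarith
  · rw [Metric.le_infDist ⟨q, hq⟩]
    intro w (hw : w.re = 0)
    have hw0 := w.im_pos
    rw [← abs_of_nonneg (dist_nonneg (x := p) (y := w)), ← abs_of_nonneg hr, ← cosh_le_cosh,
      hcosh, UpperHalfPlane.cosh_dist', hx, hy, hw, div_le_div_iff₀ hy0 (by positivity)]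
    nlinarith [mul_nonneg hy0.le (sq_nonneg (s - w.im))]
end

section
/- Let 0 < θ₀ ≤ π/3 and 0 < t < 1/2. Let Y = {z ∈ ℍ : Re(z) = 0} be the vertical geodesic over 0 in the hyperbolic upper half-plane ℍ. Let p ∈ ℍ and let q ∈ ℍ be the point with Re(q) = 0 and Im(q) = Im(p). If infDist(p, Y) < t, then the open hyperbolic ball of radius arsinh(sinh(t)·sin θ₀) around p is contained in the open hyperbolic ball of radius 2t around q. -/
open Real

theorem sinh_le_mul_of_le_half {t : ℝ} (ht0 : 0 ≤ t) (ht1 : t ≤ 1 / 2) :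
    Real.sinh t ≤ 19 / 18 * t := by
  have h1 := Real.exp_bound (x := t) (by rw [abs_of_nonneg ht0]; linarith) (n := 3) (by norm_num)
  have h2 := Real.exp_bound (x := -t) (by rw [abs_neg, abs_of_nonneg ht0]; linarith)
    (n := 3) (by norm_num)
  rw [abs_neg] at h2
  rw [abs_of_nonneg ht0] at h1 h2
  norm_num [Finset.sum_range_succ, Nat.factorial] at h1 h2
  have h3 := (abs_le.1 h1).2
  have h4 := (abs_le.1 h2).1
  rw [Real.sinh_eq]
  have h5 : t ^ 3 ≤ t * (1 / 4) := by
    rw [pow_succ']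
    gcongr
    nlinarith
  linarith

/-- A point `z` lies at distance at least `arsinh (|z.re| / z.im)` from every point of the
vertical geodesic over `0`. -/
theorem abs_re_div_im_le_sinh_dist (z w : UpperHalfPlane) (hw : w.re = 0) :
    |z.re| / z.im ≤ Real.sinh (dist z w) := by
  refine abs_le_of_sq_le_sq' ?_ (Real.sinh_nonneg_iff.2 dist_nonneg) |>.2
  rw [Real.sinh_sq, UpperHalfPlane.cosh_dist', hw, sub_zero, div_pow, sq_abs]
  have hz := z.im_pos
  have hv := w.im_pos
  rw [le_sub_iff_add_le, div_add_one (by positivity), div_pow,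
    div_le_div_iff₀ (by positivity) (by positivity)]
  nlinarith [mul_nonneg (sq_nonneg z.im) (sq_nonneg (z.re ^ 2 + z.im ^ 2 - w.im ^ 2))]

theorem arsinh_le_self {x : ℝ} (hx : 0 ≤ x) : Real.arsinh x ≤ x := by
  simpa using Real.self_le_sinh_iff.2 (Real.arsinh_nonneg_iff.2 hx)

/-- Lemma 2.12: if `p` is at hyperbolic distance less than `t < 1/2` from the vertical
geodesic `Y` over `0`, and `q` is the point of `Y` at the same height as `p`, then the ball
of radius `arsinh (sinh t · sin θ₀)` around `p` is contained in the ball of radius `2t`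
around `q`. -/
theorem ball_subset_ball_of_near_geodesic (θ₀ t : ℝ) (hθ0 : 0 < θ₀) (hθ1 : θ₀ ≤ π / 3)
    (ht0 : 0 < t) (ht1 : t < 1 / 2)
    (p q : UpperHalfPlane) (hqre : q.re = 0) (hqim : q.im = p.im)
    (h : Metric.infDist p {z : UpperHalfPlane | z.re = 0} < t) :
    Metric.ball p (Real.arsinh (Real.sinh t * Real.sin θ₀)) ⊆ Metric.ball q (2 * t) := by
  obtain ⟨z, hz, hpz⟩ := (Metric.infDist_lt_iff ⟨q, hqre⟩).1 h
  have hsinh := sinh_le_mul_of_le_half ht0.le ht1.le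
  have hsinh0 : 0 < Real.sinh t := Real.sinh_pos_iff.2 ht0
  have hpq : dist p q ≤ Real.sinh t := by
    have hdist : dist (p : ℂ) q = |p.re| := by
      have hsub : (p : ℂ) - q = (p.re : ℂ) := by
        apply Complex.ext <;> simp [hqre, hqim]
      rw [dist_eq_norm, hsub, Complex.norm_real, Real.norm_eq_abs]
    calc dist p q ≤ dist (p : ℂ) q / √(p.im * q.im) :=
          UpperHalfPlane.dist_le_dist_coe_div_sqrt p q
      _ = |p.re| / p.im := by rw [hdist, hqim, Real.sqrt_mul_self p.im_pos.le]
      _ ≤ Real.sinh (dist p z) := abs_re_div_im_le_sinh_dist p z hz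
      _ ≤ Real.sinh t := Real.sinh_le_sinh.2 hpz.le
  have hsin0 : 0 ≤ Real.sin θ₀ :=
    Real.sin_nonneg_of_nonneg_of_le_pi hθ0.le (by linarith [Real.pi_pos])
  have hsin : Real.sin θ₀ ≤ 7 / 8 := by
    calc Real.sin θ₀ ≤ Real.sin (π / 3) :=
          Real.sin_le_sin_of_le_of_le_pi_div_two (by linarith [Real.pi_pos])
            (by linarith [Real.pi_pos]) hθ1
      _ = √3 / 2 := Real.sin_pi_div_three
      _ ≤ 7 / 8 := by
        have : √3 ≤ 7 / 4 := Real.sqrt_le_iff.2 (by norm_num)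
        linarith
  apply Metric.ball_subset_ball'
  have hr := arsinh_le_self (mul_nonneg hsinh0.le hsin0)
  nlinarith [mul_le_mul_of_nonneg_left hsin hsinh0.le]
end

section
/- For all real numbers t with 0 < t < 1/2 and all θ₀ with 0 < θ₀ ≤ π/3, sinh(t) + arsinh(sinh(t)·sin θ₀) < 2t. -/
open Real

theorem sinh_le_self_add_cube {t : ℝ} (ht : |t| ≤ 1) :
    Real.sinh t ≤ t + 2 / 9 * |t| ^ 3 := by
  have h₁ := (abs_le.1 (Real.exp_bound ht (n := 3) (by norm_num))).2
  have h₂ := (abs_le.1 (Real.exp_bound (x := -t) (by rwa [abs_neg]) (n := 3) (by norm_num))).1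
  rw [abs_neg] at h₂
  norm_num [Finset.sum_range_succ, Nat.factorial] at h₁ h₂
  rw [Real.sinh_eq]
  linarith

/-- The key inequality in Lemma 2.12: `sinh t + arsinh (sinh t · sin θ₀) < 2t`
for `0 < t < 1/2` and `0 < θ₀ ≤ π/3`. -/
theorem sinh_add_arsinh_lt (t θ₀ : ℝ) (ht0 : 0 < t) (ht1 : t < 1 / 2)
    (hθ0 : 0 < θ₀) (hθ1 : θ₀ ≤ π / 3) :
    Real.sinh t + Real.arsinh (Real.sinh t * Real.sin θ₀) < 2 * t := by
  have hsinh : 0 < Real.sinh t := Real.sinh_pos_iff.2 ht0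
  have hsin : 0 ≤ Real.sin θ₀ := Real.sin_nonneg_of_nonneg_of_le_pi hθ0.le (by linarith [pi_pos])
  have hsin_le : Real.sin θ₀ ≤ 7 / 8 := by
    have h := Real.sin_le_sin_of_le_of_le_pi_div_two (by linarith [pi_pos])
      (by linarith [pi_pos]) hθ1
    rw [Real.sin_pi_div_three] at h
    have : √3 ≤ 7 / 4 := Real.sqrt_le_iff.2 (by norm_num)
    linarith
  have hsinh_le : Real.sinh t ≤ 19 / 18 * t := by
    have h := sinh_le_self_add_cube (t := t) (by rw [abs_of_pos ht0]; linarith)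
    rw [abs_of_pos ht0] at h
    have : t ^ 2 ≤ 1 / 4 := by nlinarith
    nlinarith
  calc Real.sinh t + Real.arsinh (Real.sinh t * Real.sin θ₀)
      ≤ Real.sinh t + Real.sinh t * Real.sin θ₀ := by
        gcongr
        exact arsinh_le_self (mul_nonneg hsinh.le hsin)
    _ ≤ Real.sinh t + Real.sinh t * (7 / 8) := by gcongr
    _ < 2 * t := by linarith
end

section
/- Let m ≥ 1 be a natural number, let 0 < θ₀ ≤ π/3, let ε > 0 and let v ≥ 1 be real numbers. Define l₀ = (sin θ₀)^(4m)·(√(m² + 2m) − m)/(4m) and z₀ = √(2·m·v·(cos θ₀/sin θ₀))/(ε·sin θ₀). Then l₀·sin θ₀/z₀ < (3^(1/4)/(4√2))·ε; in particular l₀·sin θ₀/z₀ < ε. -/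
open Real

theorem sqrt_sq_add_two_mul_sub_lt_one {x : ℝ} (hx : 0 ≤ x) :
    Real.sqrt (x ^ 2 + 2 * x) - x < 1 := by
  have h : Real.sqrt (x ^ 2 + 2 * x) < x + 1 := by
    rw [Real.sqrt_lt' (by linarith)]
    nlinarith
  linarith

theorem inv_sqrt_three_le_cos_div_sin {θ : ℝ} (hθ0 : 0 < θ) (hθ1 : θ ≤ π / 3) :
    1 / Real.sqrt 3 ≤ Real.cos θ / Real.sin θ := by
  have hsin : 0 < Real.sin θ := Real.sin_pos_of_pos_of_lt_pi hθ0 (by linarith [Real.pi_pos])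
  have hs : Real.sin θ ≤ Real.sqrt 3 / 2 := by
    rw [← Real.sin_pi_div_three]
    exact Real.sin_le_sin_of_le_of_le_pi_div_two (by linarith [Real.pi_pos])
      (by linarith [Real.pi_pos]) hθ1
  have hc : 1 / 2 ≤ Real.cos θ := by
    rw [← Real.cos_pi_div_three]
    exact Real.cos_le_cos_of_nonneg_of_le_pi hθ0.le (by linarith [Real.pi_pos]) hθ1
  have h3 : 0 < Real.sqrt 3 := by positivity
  rw [div_le_div_iff₀ h3 hsin]
  nlinarith

theorem sq_three_rpow_one_fourth : ((3 : ℝ) ^ ((1 : ℝ) / 4)) ^ 2 = Real.sqrt 3 := by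
  rw [← Real.rpow_natCast, ← Real.rpow_mul (by norm_num), Real.sqrt_eq_rpow]
  norm_num

/-- The explicit computation of Lemma 2.13: with `l₀` and `z₀` as in the paper,
`l₀ sin θ₀ / z₀ < 3^{1/4} ε/(4√2) < ε`. -/
theorem l0_sin_div_z0_lt (m : ℕ) (hm : 1 ≤ m) (θ₀ ε v : ℝ)
    (hθ0 : 0 < θ₀) (hθ1 : θ₀ ≤ π / 3) (hε : 0 < ε) (hv : 1 ≤ v) :
    (Real.sin θ₀) ^ (4 * m) * (Real.sqrt ((m : ℝ) ^ 2 + 2 * m) - m) / (4 * m)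
        * Real.sin θ₀
        / (Real.sqrt (2 * m * v * (Real.cos θ₀ / Real.sin θ₀)) / (ε * Real.sin θ₀))
      < (3 ^ ((1 : ℝ) / 4) / (4 * Real.sqrt 2)) * ε ∧
    (Real.sin θ₀) ^ (4 * m) * (Real.sqrt ((m : ℝ) ^ 2 + 2 * m) - m) / (4 * m)
        * Real.sin θ₀
        / (Real.sqrt (2 * m * v * (Real.cos θ₀ / Real.sin θ₀)) / (ε * Real.sin θ₀))
      < ε := by
  have hm' : (1 : ℝ) ≤ m := by exact_mod_cast hm
  have hs : 0 < Real.sin θ₀ :=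
    Real.sin_pos_of_pos_of_lt_pi hθ0 (by linarith [Real.pi_pos])
  have hs1 := Real.sin_le_one θ₀
  have hcot := inv_sqrt_three_le_cos_div_sin hθ0 hθ1
  have hA := sqrt_sq_add_two_mul_sub_lt_one (x := (m : ℝ)) (by linarith)
  have hK : (0 : ℝ) < 3 ^ ((1 : ℝ) / 4) := by positivity
  have hK2 := sq_three_rpow_one_fourth
  set K : ℝ := 3 ^ ((1 : ℝ) / 4)
  have h2 : 0 < Real.sqrt 2 := by positivity
  have hD : Real.sqrt 2 / K ≤ Real.sqrt (2 * m * v * (Real.cos θ₀ / Real.sin θ₀)) := by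
    apply Real.le_sqrt_of_sq_le
    rw [div_pow, hK2, Real.sq_sqrt (by norm_num)]
    calc 2 / Real.sqrt 3 = 2 * 1 * 1 * (1 / Real.sqrt 3) := by ring
      _ ≤ 2 * m * v * (Real.cos θ₀ / Real.sin θ₀) := by gcongr
  have hKlt : K / (4 * Real.sqrt 2) < 1 := by
    rw [div_lt_one (by positivity)]
    have h3 : Real.sqrt 3 < 2 := by
      rw [Real.sqrt_lt' (by norm_num)]
      norm_num
    have h21 : 1 ≤ Real.sqrt 2 := Real.one_le_sqrt.2 (by norm_num)
    nlinarith
  set A := Real.sqrt ((m : ℝ) ^ 2 + 2 * m) - m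
  set D := Real.sqrt (2 * m * v * (Real.cos θ₀ / Real.sin θ₀))
  have hD0 : 0 < D := lt_of_lt_of_le (by positivity) hD
  have hA0 : 0 ≤ A := sub_nonneg.2 (Real.le_sqrt_of_sq_le (by linarith))
  have hAm : A / (4 * m) < 1 / 4 := by
    rw [div_lt_div_iff₀ (by positivity) (by norm_num)]
    linarith
  have hpow : Real.sin θ₀ ^ (4 * m + 2) ≤ 1 := pow_le_one₀ hs.le hs1
  have hmain : Real.sin θ₀ ^ (4 * m) * A / (4 * m) * Real.sin θ₀ / (D / (ε * Real.sin θ₀))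
      < K / (4 * Real.sqrt 2) * ε := by
    rw [div_div_eq_mul_div, div_lt_iff₀ hD0]
    calc Real.sin θ₀ ^ (4 * m) * A / (4 * m) * Real.sin θ₀ * (ε * Real.sin θ₀)
        = Real.sin θ₀ ^ (4 * m + 2) * (A / (4 * m)) * ε := by ring
      _ ≤ 1 * (A / (4 * m)) * ε := by gcongr
      _ < 1 * (1 / 4) * ε := by gcongr
      _ = K / (4 * Real.sqrt 2) * ε * (Real.sqrt 2 / K) := by field_simp
      _ ≤ K / (4 * Real.sqrt 2) * ε * D := by gcongr
  exact ⟨hmain, hmain.trans (mul_lt_of_lt_one_left hε hKlt)⟩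
end

section
/- For every real number a > 0 with sinh(a) < 1, sinh(a/2) > (√3/4)·sinh(a). -/
/-- Half-angle estimate: for `a > 0` with `sinh a < 1`, `sinh (a/2) > (√3/4) sinh a`. -/
theorem sinh_half_gt (a : ℝ) (ha : 0 < a) (hs : Real.sinh a < 1) :
    Real.sqrt 3 / 4 * Real.sinh a < Real.sinh (a / 2) := by
  have double : Real.sinh a = 2 * Real.sinh (a / 2) * Real.cosh (a / 2) := by
    rw [← Real.sinh_two_mul, mul_div_cancel₀ a two_ne_zero]
  have sinh_pos : 0 < Real.sinh (a / 2) := Real.sinh_pos_iff.mpr (half_pos ha)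
  have cosh_pos := Real.cosh_pos (a / 2)
  have cosh_sq := Real.cosh_sq (a / 2)
  rw [double] at hs ⊢
  set s := Real.sinh (a / 2)
  set c := Real.cosh (a / 2)
  have prod_sq : (2 * s * c) ^ 2 < 1 := pow_lt_one₀ (by positivity) hs two_ne_zero
  have cosh_sq_lt : c ^ 2 < 4 / 3 := by
    rw [mul_pow, cosh_sq] at prod_sq
    nlinarith [sq_nonneg s]
  have sqrt_mul_lt : Real.sqrt 3 * c < 2 := by
    refine lt_of_pow_lt_pow_left₀ 2 zero_le_two ?_
    rw [mul_pow, Real.sq_sqrt (by norm_num)]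
    linarith
  calc Real.sqrt 3 / 4 * (2 * s * c) = s * (Real.sqrt 3 * c) / 2 := by ring
    _ < s * 2 / 2 := by gcongr
    _ = s := by ring
end
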